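/- Fix an integer r ≥ 1 and let s, B, b_0,…,b_{2r+1}, t_1, t_2, g_1, g_2 be as defined; set P := b_1⋯b_{2r} and Q := b_2⋯b_{2r−1}, let b′ and b″ be the integers with 2b′ = 1 + P + 2t_1 and 3b″ = 1 + 8Q + 12t_2, and define m′ := 2·b′·g_1 − 1 and m″ := 3·b″·g_2 − 2. Let α := 2·Π_{j=1}^{∞} (s_{j+1}/(s_j − 1)²)^(2^(j−1)) (a convergent infinite product of positive reals). Then, as real numbers, m″ ≥ 8(s_{2r} − 1)(2s_{2r} − 3)/(9α) and m′ ≥ 7(s_{2r+1} − 1)(2s_{2r+1} − 3)/(6α²). (This is Lemma 8.2: the conjectural index m′_n of the Esser–Totaro–Wang klt Calabi–Yau variety of dimension n satisfies m′_n ≥ (s_n − 1)(2s_n − 3)/(9α/8) for n = 2r even and m′_n ≥ (s_n − 1)(2s_n − 3)/(6α²/7) for n = 2r+1 odd, where m′_{2r} = m″ and m′_{2r+1} = m′.) -/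

import Mathlib

/-- Sylvester's sequence: `s 0 = 2`, `s (j+1) = s j * (s j − 1) + 1`;
it begins 2, 3, 7, 43, 1807, …. -/
def sylv : ℕ → ℕ
  | 0 => 2
  | n + 1 => sylv n * (sylv n - 1) + 1

/-- The alternating sum `B(x₁,…,x_k) = ∑_{j=0}^{k} (−1)^{k−j} x₁⋯x_j`
(the empty product being 1), characterized by `B [] = 1` and
`B (x :: xs) = x * B xs + (−1)^(length (x :: xs))`. -/
def Bsum : List ℤ → ℤ
  | [] => 1
  | x :: xs => x * Bsum xs + (-1) ^ (xs.length + 1)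

/-- `Zl r t` is the list of length `2t` formed by concatenating the pairs
`(b_{r+u}, b_{r+1−u})` for `u = 1, …, t`, where `b` are the exponents
defined inductively together with this list. -/
def Zl (r : ℕ) : ℕ → List ℤ
  | 0 => []
  | t + 1 => Zl r t ++ [1 + ((sylv (r - t) : ℤ) - 1) ^ 2 * Bsum (Zl r t), (sylv (r - t) : ℤ)]

/-- The exponents `b_0, …, b_{2r+1}`: `b_j = s_j` for `j ≤ r`, and
`b_{r+i} = 1 + (b_{r+1−i} − 1)² · B(Z_{i−1})` for `1 ≤ i ≤ r+1`
(here, for `j = r + i`, one has `b_{r+1−i} = s_{2r+1−j}`). -/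
def bexp (r j : ℕ) : ℤ :=
  if j ≤ r then (sylv j : ℤ)
  else 1 + ((sylv (2 * r + 1 - j) : ℤ) - 1) ^ 2 * Bsum (Zl r (j - r - 1))

/-- The list `L_k = (b_{r+1}, b_r, b_{r+2}, b_{r−1}, …, b_{2r+1−k}, b_k)`,
formed by concatenating the pairs `(b_{r+t}, b_{r+1−t})` for `t = 1, …, r+1−k`. -/
def Lk (r k : ℕ) : List ℤ := Zl r (r + 1 - k)

/-- `t_k := B(L_k)`. -/
def tB (r k : ℕ) : ℤ := Bsum (Lk r k)

/-- `g_k := B(reverse of L_k)`. -/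
def gB (r k : ℕ) : ℤ := Bsum (Lk r k).reverse

/-- `T_k`: the alternating sum of `B` over the suffixes of `L_k`
(the full list with sign `+`, the empty suffix contributing `+1`). -/
def TB (r k : ℕ) : ℤ :=
  ∑ m ∈ Finset.range ((Lk r k).length + 1), (-1) ^ m * Bsum ((Lk r k).drop m)

/-- `w_k := (s_k − 1)·T_k − 1`. -/
def wB (r k : ℕ) : ℤ := ((sylv k : ℤ) - 1) * TB r k - 1

theorem Bsum_append_singleton (l : List ℤ) (x : ℤ) :
    Bsum (l ++ [x]) = l.prod * x - Bsum l := by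
  induction l with
  | nil => simp [Bsum, sub_eq_add_neg]
  | cons y l ih =>
    simp only [List.cons_append, Bsum, ih, List.prod_cons, List.length_append, List.length_singleton]
    ring

theorem Bsum_bounds (l : List ℤ) (hl : ∀ x ∈ l, 1 ≤ x) :
    0 ≤ Bsum l ∧ Bsum l ≤ l.prod ∧ 1 ≤ l.prod := by
  induction l using List.reverseRecOn with
  | nil => simp [Bsum]
  | append_singleton l x ih =>
    obtain ⟨h0, h1, h2⟩ := ih fun y hy => hl y (by simp [hy])
    have hx : 1 ≤ x := hl x (by simp)
    rw [Bsum_append_singleton, List.prod_append, List.prod_singleton]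
    refine ⟨?_, ?_, ?_⟩ <;> nlinarith

theorem two_le_sylv (j : ℕ) : 2 ≤ sylv j := by
  induction j with
  | zero => simp [sylv]
  | succ j ih =>
    have : 1 ≤ sylv j - 1 := by omega
    rw [sylv]
    nlinarith

theorem one_le_of_mem_Zl (r t : ℕ) : ∀ x ∈ Zl r t, 1 ≤ x := by
  induction t with
  | zero => simp [Zl]
  | succ t ih =>
    intro x hx
    have hB := (Bsum_bounds _ ih).1
    have hs : (2 : ℤ) ≤ sylv (r - t) := by exact_mod_cast two_le_sylv (r - t)
    simp only [Zl, List.mem_append, List.mem_cons, List.not_mem_nil, or_false] at hx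
    rcases hx with hx | rfl | rfl
    · exact ih x hx
    · have := mul_nonneg (sq_nonneg ((sylv (r - t) : ℤ) - 1)) hB
      linarith
    · linarith

theorem Bsum_Zl_succ (r t : ℕ) :
    Bsum (Zl r (t + 1)) =
      (Zl r t).prod * (1 + ((sylv (r - t) : ℤ) - 1) ^ 2 * Bsum (Zl r t)) *
        ((sylv (r - t) : ℤ) - 1) + Bsum (Zl r t) := by
  rw [Zl, List.append_cons, Bsum_append_singleton, Bsum_append_singleton,
    List.prod_append, List.prod_singleton]
  ring

theorem prod_Zl_succ (r t : ℕ) :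
    (Zl r (t + 1)).prod =
      (Zl r t).prod * (1 + ((sylv (r - t) : ℤ) - 1) ^ 2 * Bsum (Zl r t)) * (sylv (r - t) : ℤ) := by
  rw [Zl, List.prod_append, List.prod_cons, List.prod_singleton]
  ring

theorem prod_Zl_eq_prod_bexp (r t j : ℕ) (h : j + t = r) :
    (Zl r t).prod = ∏ i ∈ Finset.Icc (j + 1) (r + t), bexp r i := by
  induction t generalizing j with
  | zero => simp [Zl, ← h]
  | succ t ih =>
    rw [prod_Zl_succ, ih (j + 1) (by omega), ← add_assoc r t 1,
      Finset.prod_Icc_succ_top (by omega),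
      ← Finset.mul_prod_Ioc_eq_prod_Icc (a := j + 1) (b := r + t) (by omega),
      ← Finset.Icc_succ_left_eq_Ioc, Order.succ_eq_add_one]
    have h1 : bexp r (j + 1) = sylv (r - t) := by
      rw [bexp, if_pos (by omega)]
      congr 2
      omega
    have h2 : bexp r (r + t + 1) = 1 + ((sylv (r - t) : ℤ) - 1) ^ 2 * Bsum (Zl r t) := by
      rw [bexp, if_neg (by omega), show 2 * r + 1 - (r + t + 1) = r - t by omega,
        show r + t + 1 - r - 1 = t by omega]
    rw [h1, h2]
    ring

theorem prod_Zl_mul_le (r t : ℕ) :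
    (Zl r (t + 1)).prod * ((sylv (r - t) : ℤ) - 1) ≤ Bsum (Zl r (t + 1)) * sylv (r - t) := by
  have h := (Bsum_bounds _ (one_le_of_mem_Zl r t)).1
  rw [prod_Zl_succ, Bsum_Zl_succ]
  have := mul_nonneg h (Int.natCast_nonneg (sylv (r - t)))
  linarith

theorem exists_Zl_succ_eq_cons (r t : ℕ) :
    ∃ l, Zl r (t + 1) = (1 + ((sylv r : ℤ) - 1) ^ 2) :: l := by
  induction t with
  | zero => exact ⟨[(sylv r : ℤ)], by simp [Zl, Bsum]⟩
  | succ t ih =>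
    obtain ⟨l, hl⟩ := ih
    rw [Zl, hl]
    exact ⟨_, List.cons_append⟩

theorem Bsum_reverse_Zl_bounds (r t : ℕ) :
    (Zl r (t + 1)).prod * ((sylv r : ℤ) - 1) ^ 2 ≤
        Bsum (Zl r (t + 1)).reverse * (1 + ((sylv r : ℤ) - 1) ^ 2) ∧
      ((sylv r : ℤ) - 1) ^ 2 ≤ Bsum (Zl r (t + 1)).reverse := by
  obtain ⟨l, hl⟩ := exists_Zl_succ_eq_cons r t
  have hmem := one_le_of_mem_Zl r (t + 1)
  rw [hl] at hmem ⊢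
  obtain ⟨-, h1, h2⟩ := Bsum_bounds l.reverse fun x hx => hmem x (by simp_all)
  rw [List.reverse_cons, Bsum_append_singleton, List.prod_cons]
  rw [List.prod_reverse] at *
  have hc := sq_nonneg ((sylv r : ℤ) - 1)
  generalize ((sylv r : ℤ) - 1) ^ 2 = c at *
  constructor <;> nlinarith

/-- The predecessor `s_j − 1` of a term of Sylvester's sequence, as a real number. -/
noncomputable def sylvPred (j : ℕ) : ℝ := (sylv j : ℝ) - 1

/-- The ratio `s_{j+1}/(s_j − 1)²`. -/
noncomputable def sylvRatio (j : ℕ) : ℝ := (sylv (j + 1) : ℝ) / ((sylv j : ℝ) - 1) ^ 2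

theorem one_le_sylvPred (j : ℕ) : 1 ≤ sylvPred j := by
  have : (2 : ℝ) ≤ sylv j := by exact_mod_cast two_le_sylv j
  rw [sylvPred]
  linarith

theorem sylvPred_succ (j : ℕ) : sylvPred (j + 1) = sylvPred j * (sylvPred j + 1) := by
  have := two_le_sylv j
  rw [sylvPred, sylvPred, sylv]
  push_cast [Nat.cast_sub (by omega : 1 ≤ sylv j)]
  ring

theorem sylvRatio_mul_sq (j : ℕ) :
    sylvRatio j * sylvPred j ^ 2 = sylvPred j ^ 2 + sylvPred j + 1 := by
  have h := one_le_sylvPred j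
  have h' : (sylv (j + 1) : ℝ) = sylvPred (j + 1) + 1 := by simp [sylvPred]
  rw [sylvRatio, h', sylvPred_succ, ← sylvPred]
  field_simp

theorem one_le_sylvRatio (j : ℕ) : 1 ≤ sylvRatio j := by
  have h := one_le_sylvPred j
  have h' := sylvRatio_mul_sq j
  by_contra! hlt
  nlinarith [mul_pos (sub_pos.2 hlt) (pow_pos (by linarith : 0 < sylvPred j) 2)]

theorem sylvPred_succ_le (j : ℕ) : sylvPred (j + 1) ≤ sylvPred j ^ 2 * sylvRatio j := by
  rw [mul_comm, sylvRatio_mul_sq, sylvPred_succ]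
  linarith

/-- The growth of Sylvester's sequence is controlled by the ratios `sylvRatio`. -/
theorem sylvPred_add_le (n k : ℕ) :
    sylvPred (n + k) ≤
      sylvPred n ^ 2 ^ k * ∏ i ∈ Finset.range k, sylvRatio (n + i) ^ 2 ^ (k + i) := by
  induction k with
  | zero => simp
  | succ k ih =>
    have ha := one_le_sylvPred (n + k)
    have hf := one_le_sylvRatio (n + k)
    calc sylvPred (n + (k + 1)) ≤ sylvPred (n + k) ^ 2 * sylvRatio (n + k) :=
          sylvPred_succ_le (n + k)
      _ ≤ (sylvPred n ^ 2 ^ k * ∏ i ∈ Finset.range k, sylvRatio (n + i) ^ 2 ^ (k + i)) ^ 2 *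
            sylvRatio (n + k) ^ 2 ^ (k + 1 + k) := by
          gcongr
          exact le_self_pow₀ hf (by positivity)
      _ = _ := by
          rw [Finset.prod_range_succ, mul_pow, ← Finset.prod_pow, ← pow_mul, ← pow_succ, mul_assoc]
          congr 2
          refine Finset.prod_congr rfl fun i _ => ?_
          rw [← pow_mul, ← pow_succ, show k + 1 + i = k + i + 1 by omega]

theorem sylvPred_pow_le_prod_Zl (r t j : ℕ) (h : j + t = r) :
    sylvPred (r + 2) ^ 2 ^ t ≤
      (((Zl r (t + 1)).prod : ℤ) : ℝ) * sylvPred j *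
        ∏ i ∈ Finset.range (t + 1), sylvRatio (j + i) ^ 2 ^ i := by
  have ha := one_le_sylvPred j
  have hf := one_le_sylvRatio j
  have hcast : (sylv j : ℝ) = sylvPred j + 1 := by simp [sylvPred]
  have hmul := sylvRatio_mul_sq j
  have hsucc := sylvPred_succ j
  induction t generalizing j with
  | zero =>
    obtain rfl : j = r := by omega
    rw [prod_Zl_succ]
    simp only [Zl, Bsum, List.prod_nil, Nat.sub_zero, zero_add, Finset.range_one,
      Finset.prod_singleton, pow_zero, pow_one, add_zero]
    push_cast
    rw [hcast, sylvPred_succ (j + 1), hsucc]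
    generalize sylvPred j = a at *
    generalize sylvRatio j = f at *
    have : (1 * (1 + (a + 1 - 1) ^ 2 * 1) * (a + 1)) * a * f =
        f * (a * (a + 1)) + (f * a ^ 2) * (a * (a + 1)) := by ring
    rw [this, hmul]
    nlinarith [mul_nonneg (by linarith : (0 : ℝ) ≤ f) (by nlinarith : 0 ≤ a * (a + 1))]
  | succ t ih =>
    have ha' := one_le_sylvPred (j + 1)
    have IH := ih (j + 1) (by omega) ha' (one_le_sylvRatio _) (by simp [sylvPred])
      (sylvRatio_mul_sq _) (sylvPred_succ _)
    have hj : r - (t + 1) = j := by omega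
    have hlow := prod_Zl_mul_le r t
    rw [show r - t = j + 1 by omega] at hlow
    have hpos : (1 : ℤ) ≤ (Zl r (t + 1)).prod := (Bsum_bounds _ (one_le_of_mem_Zl _ _)).2.2
    rw [prod_Zl_succ, hj, Finset.prod_range_succ']
    have hprod : ∏ i ∈ Finset.range (t + 1), sylvRatio (j + (i + 1)) ^ 2 ^ (i + 1) =
        (∏ i ∈ Finset.range (t + 1), sylvRatio (j + 1 + i) ^ 2 ^ i) ^ 2 := by
      rw [← Finset.prod_pow]
      refine Finset.prod_congr rfl fun i _ => ?_
      rw [← pow_mul, ← pow_succ, show j + (i + 1) = j + 1 + i by omega]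
    rw [hprod]
    have hlow' : (((Zl r (t + 1)).prod : ℤ) : ℝ) * sylvPred (j + 1) ≤
        ((Bsum (Zl r (t + 1)) : ℤ) : ℝ) * (sylvPred (j + 1) + 1) := by
      have := (Int.cast_le (R := ℝ)).2 hlow
      push_cast at this
      simpa [sylvPred] using this
    have hpos' : (1 : ℝ) ≤ (((Zl r (t + 1)).prod : ℤ) : ℝ) := by exact_mod_cast hpos
    have hG : 0 ≤ ∏ i ∈ Finset.range (t + 1), sylvRatio (j + 1 + i) ^ 2 ^ i :=
      Finset.prod_nonneg fun i _ => by
        have := one_le_sylvRatio (j + 1 + i)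
        positivity
    simp only [Int.cast_mul, Int.cast_add, Int.cast_one, Int.cast_pow, Int.cast_sub,
      Int.cast_natCast]
    rw [hcast]
    generalize (∏ i ∈ Finset.range (t + 1), sylvRatio (j + 1 + i) ^ 2 ^ i) = G at *
    generalize (((Zl r (t + 1)).prod : ℤ) : ℝ) = p at *
    generalize ((Bsum (Zl r (t + 1)) : ℤ) : ℝ) = β at *
    rw [pow_succ 2 t, pow_mul]
    have hsq : (sylvPred (r + 2) ^ 2 ^ t) ^ 2 ≤ (p * sylvPred (j + 1) * G) ^ 2 := by
      have := one_le_sylvPred (r + 2)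
      gcongr
    refine hsq.trans ?_
    have key : p * sylvPred (j + 1) ^ 2 ≤
        (1 + (sylvPred j + 1 - 1) ^ 2 * β) * (sylvPred j + 1) * sylvPred j * sylvRatio j := by
      have e : (1 + (sylvPred j + 1 - 1) ^ 2 * β) * (sylvPred j + 1) * sylvPred j * sylvRatio j =
          sylvRatio j * sylvPred (j + 1) +
            sylvPred (j + 1) * (β * (sylvPred (j + 1) + 1)) := by
        have e' : sylvRatio j * sylvPred j ^ 2 = sylvPred (j + 1) + 1 := by
          rw [hmul, hsucc]
          ring
        rw [← e', hsucc]
        ring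
      rw [e]
      have := mul_le_mul_of_nonneg_left hlow' (by linarith : 0 ≤ sylvPred (j + 1))
      have := mul_nonneg (by linarith : 0 ≤ sylvRatio j) (by linarith : 0 ≤ sylvPred (j + 1))
      linarith
    have := mul_le_mul_of_nonneg_left key (by positivity : 0 ≤ p * G ^ 2)
    simp only [add_zero, pow_zero, pow_one]
    linarith

theorem prod_sylvRatio_Icc (N : ℕ) :
    ∏ j ∈ Finset.Icc 1 N, sylvRatio j ^ 2 ^ (j - 1) =
      ∏ i ∈ Finset.range N, sylvRatio (i + 1) ^ 2 ^ i := by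
  induction N with
  | zero => simp
  | succ N ih =>
    rw [Finset.prod_Icc_succ_top (by omega), ih, Finset.prod_range_succ, Nat.add_sub_cancel]

theorem prod_sylvRatio_le_of_tendsto {α : ℝ}
    (hα : Filter.Tendsto
      (fun N : ℕ => 2 * ∏ j ∈ Finset.Icc 1 N,
        ((sylv (j + 1) : ℝ) / ((sylv j : ℝ) - 1) ^ 2) ^ 2 ^ (j - 1))
      Filter.atTop (nhds α)) (N : ℕ) :
    2 * ∏ i ∈ Finset.range N, sylvRatio (i + 1) ^ 2 ^ i ≤ α := by
  have hα' : Filter.Tendsto (fun N : ℕ => 2 * ∏ i ∈ Finset.range N, sylvRatio (i + 1) ^ 2 ^ i)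
      Filter.atTop (nhds α) := by
    refine hα.congr fun N => ?_
    rw [← prod_sylvRatio_Icc]
    rfl
  refine Monotone.ge_of_tendsto (monotone_nat_of_le_succ fun N => ?_) hα' N
  have hpos : 0 ≤ ∏ i ∈ Finset.range N, sylvRatio (i + 1) ^ 2 ^ i :=
    Finset.prod_nonneg fun i _ => by
      have := one_le_sylvRatio (i + 1)
      positivity
  rw [Finset.prod_range_succ]
  have := one_le_pow₀ (n := 2 ^ N) (one_le_sylvRatio (N + 1))
  nlinarith

theorem one_add_sq_le_sylvRatio_sq (r : ℕ) :
    1 + sylvPred r ^ 2 ≤ sylvRatio (r + 1) ^ 2 * sylvPred r ^ 2 := by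
  have ha := one_le_sylvPred r
  have hd := one_le_sylvPred (r + 1)
  have hsucc := sylvPred_succ r
  have hm := sylvRatio_mul_sq (r + 1)
  have h1 : sylvPred (r + 1) + 1 ≤ sylvRatio (r + 1) * sylvPred (r + 1) := by
    by_contra! h
    nlinarith
  have hle : sylvPred (r + 1) ≤ 2 * sylvPred r ^ 2 := by nlinarith
  have hf : 1 + 1 / sylvPred (r + 1) ≤ sylvRatio (r + 1) := by
    rw [← sub_nonneg]
    have : sylvRatio (r + 1) - (1 + 1 / sylvPred (r + 1)) =
        (sylvRatio (r + 1) * sylvPred (r + 1) - (sylvPred (r + 1) + 1)) / sylvPred (r + 1) := by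
      field_simp
    rw [this]
    exact div_nonneg (by linarith) (by linarith)
  have hf2 : 1 + 1 / (2 * sylvPred r ^ 2) ≤ sylvRatio (r + 1) :=
    le_trans (by gcongr) hf
  calc 1 + sylvPred r ^ 2 ≤ (1 + 1 / (2 * sylvPred r ^ 2)) ^ 2 * sylvPred r ^ 2 := by
        have : (1 + 1 / (2 * sylvPred r ^ 2)) ^ 2 * sylvPred r ^ 2 =
            1 + sylvPred r ^ 2 + 1 / (4 * sylvPred r ^ 2) := by
          field_simp
          ring
        rw [this]
        have : 0 ≤ 1 / (4 * sylvPred r ^ 2) := by positivity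
        linarith
    _ ≤ _ := by gcongr

theorem prod_range_sylvRatio_split (r k e : ℕ) (he : k + e ≤ r + 1) :
    (∏ i ∈ Finset.range r, sylvRatio (i + 1) ^ 2 ^ i) * sylvRatio (r + 1) ^ 2 ^ r *
        (∏ i ∈ Finset.range k, sylvRatio (r + 2 + i) ^ 2 ^ (k + i)) ^ 2 ^ e ≤
      ∏ i ∈ Finset.range (r + 1 + k), sylvRatio (i + 1) ^ 2 ^ i := by
  have hpos : ∀ i, 0 ≤ sylvRatio i := fun i => zero_le_one.trans (one_le_sylvRatio i)
  rw [Finset.prod_range_add, Finset.prod_range_succ, ← Finset.prod_pow]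
  refine mul_le_mul_of_nonneg_left (Finset.prod_le_prod (fun i _ => ?_) fun i _ => ?_) ?_
  · have := hpos (r + 2 + i)
    positivity
  · rw [← pow_mul, ← pow_add, show r + 1 + i + 1 = r + 2 + i by omega]
    exact pow_le_pow_right₀ (one_le_sylvRatio _) (Nat.pow_le_pow_right two_pos (by omega))
  · exact mul_nonneg (Finset.prod_nonneg fun i _ => pow_nonneg (hpos _) _) (pow_nonneg (hpos _) _)

theorem sylvPred_odd_le {α : ℝ}
    (hα : ∀ N, 2 * ∏ i ∈ Finset.range N, sylvRatio (i + 1) ^ 2 ^ i ≤ α) (t : ℕ) :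
    sylvPred (2 * (t + 1) + 1) * sylvRatio (t + 2) ≤
      (((Zl (t + 1) (t + 1)).prod : ℤ) : ℝ) * α := by
  have hlow := sylvPred_pow_le_prod_Zl (t + 1) t 1 (by omega)
  have hup := sylvPred_add_le (t + 3) t
  have hsplit := prod_range_sylvRatio_split (t + 1) t 0 (by omega)
  have hf := one_le_sylvRatio (t + 2)
  have hfp : sylvRatio (t + 2) ≤ sylvRatio (t + 2) ^ 2 ^ (t + 1) :=
    le_self_pow₀ hf (by positivity)
  have hα' := hα (t + 1 + 1 + t)
  have h1 : sylvPred 1 = 2 := by norm_num [sylvPred, sylv]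
  have hP : (1 : ℝ) ≤ (((Zl (t + 1) (t + 1)).prod : ℤ) : ℝ) := by
    exact_mod_cast (Bsum_bounds _ (one_le_of_mem_Zl _ _)).2.2
  have hG : 0 ≤ ∏ i ∈ Finset.range t, sylvRatio (t + 3 + i) ^ 2 ^ (t + i) :=
    Finset.prod_nonneg fun i _ => pow_nonneg (zero_le_one.trans (one_le_sylvRatio _)) _
  rw [show 2 * (t + 1) + 1 = t + 3 + t by omega]
  simp only [pow_zero, pow_one, h1, add_comm 1] at hlow hsplit
  rw [show t + 1 + 2 = t + 3 by omega] at hlow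
  simp only [show t + 1 + 2 = t + 3 by omega, show t + 1 + 1 = t + 2 by omega] at hsplit
  rw [show t + 1 + 1 = t + 2 by omega] at hα'
  generalize (((Zl (t + 1) (t + 1)).prod : ℤ) : ℝ) = p at *
  calc _ ≤ (sylvPred (t + 3) ^ 2 ^ t *
          ∏ i ∈ Finset.range t, sylvRatio (t + 3 + i) ^ 2 ^ (t + i)) *
          sylvRatio (t + 2) ^ 2 ^ (t + 1) := by
        gcongr
        exact zero_le_one.trans (one_le_sylvPred (t + 3 + t)) |>.trans hup
    _ ≤ (p * 2 * (∏ i ∈ Finset.range (t + 1), sylvRatio (i + 1) ^ 2 ^ i) *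
          ∏ i ∈ Finset.range t, sylvRatio (t + 3 + i) ^ 2 ^ (t + i)) *
          sylvRatio (t + 2) ^ 2 ^ (t + 1) := by
        gcongr
    _ = p * (2 * ((∏ i ∈ Finset.range (t + 1), sylvRatio (i + 1) ^ 2 ^ i) *
          sylvRatio (t + 2) ^ 2 ^ (t + 1) *
          ∏ i ∈ Finset.range t, sylvRatio (t + 3 + i) ^ 2 ^ (t + i))) := by ring
    _ ≤ p * α := by
        gcongr
        linarith

theorem sylvPred_even_le {α : ℝ}
    (hα : ∀ N, 2 * ∏ i ∈ Finset.range N, sylvRatio (i + 1) ^ 2 ^ i ≤ α) (t : ℕ) :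
    sylvPred (2 * (t + 2)) ^ 2 * sylvRatio (t + 3) ^ 2 ≤
      72 / 7 * (((Zl (t + 2) (t + 1)).prod : ℤ) : ℝ) ^ 2 * α := by
  have hlow := sylvPred_pow_le_prod_Zl (t + 2) t 2 (by omega)
  have hup := sylvPred_add_le (t + 4) t
  have hsplit := prod_range_sylvRatio_split (t + 2) t 1 (by omega)
  have hf := one_le_sylvRatio (t + 3)
  have hfp : sylvRatio (t + 3) ^ 2 ≤ sylvRatio (t + 3) ^ 2 ^ (t + 2) :=
    pow_le_pow_right₀ hf (le_self_pow₀ (by norm_num) (by omega))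
  have hα' := hα (t + 2 + 1 + t)
  have h2 : sylvPred 2 = 6 := by norm_num [sylvPred, sylv]
  have hf1 : sylvRatio 1 = 7 / 4 := by norm_num [sylvRatio, sylv]
  have hfirst : ∏ i ∈ Finset.range (t + 2), sylvRatio (i + 1) ^ 2 ^ i =
      7 / 4 * (∏ i ∈ Finset.range (t + 1), sylvRatio (2 + i) ^ 2 ^ i) ^ 2 := by
    rw [Finset.prod_range_succ', ← Finset.prod_pow, mul_comm]
    simp only [zero_add, pow_zero, pow_one, hf1]
    congr 1
    refine Finset.prod_congr rfl fun i _ => ?_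
    rw [← pow_mul, ← pow_succ, show i + 1 + 1 = 2 + i by omega]
  have hG : 0 ≤ ∏ i ∈ Finset.range t, sylvRatio (t + 4 + i) ^ 2 ^ (t + i) :=
    Finset.prod_nonneg fun i _ => pow_nonneg (zero_le_one.trans (one_le_sylvRatio _)) _
  rw [show 2 * (t + 2) = t + 4 + t by omega]
  rw [hfirst] at hsplit
  simp only [pow_one, h2, show t + 2 + 2 = t + 4 by omega, show t + 2 + 1 = t + 3 by omega]
    at hlow hsplit
  rw [show t + 2 + 1 = t + 3 by omega] at hα'
  have ha := one_le_sylvPred (t + 4)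
  have ha' := one_le_sylvPred (t + 4 + t)
  generalize (((Zl (t + 2) (t + 1)).prod : ℤ) : ℝ) = p at *
  generalize (∏ i ∈ Finset.range (t + 1), sylvRatio (2 + i) ^ 2 ^ i) = H at *
  generalize (∏ i ∈ Finset.range t, sylvRatio (t + 4 + i) ^ 2 ^ (t + i)) = G at *
  calc _ ≤ (sylvPred (t + 4) ^ 2 ^ t * G) ^ 2 * sylvRatio (t + 3) ^ 2 ^ (t + 2) := by
        gcongr
    _ ≤ (p * 6 * H * G) ^ 2 * sylvRatio (t + 3) ^ 2 ^ (t + 2) := by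
        gcongr
    _ = 72 / 7 * p ^ 2 * (2 * (7 / 4 * H ^ 2 * sylvRatio (t + 3) ^ 2 ^ (t + 2) * G ^ 2)) := by
        ring
    _ ≤ 72 / 7 * p ^ 2 * α := by
        gcongr
        linarith

theorem four_le_sylvPred_succ_sq (j : ℕ) : 4 ≤ sylvPred (j + 1) ^ 2 := by
  have h := one_le_sylvPred j
  have : 2 ≤ sylvPred (j + 1) := by
    rw [sylvPred_succ]
    nlinarith
  nlinarith

theorem cast_Bsum_reverse_Zl_bounds (r t : ℕ) :
    (((Zl r (t + 1)).prod : ℤ) : ℝ) * sylvPred r ^ 2 ≤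
        ((Bsum (Zl r (t + 1)).reverse : ℤ) : ℝ) * (1 + sylvPred r ^ 2) ∧
      sylvPred r ^ 2 ≤ ((Bsum (Zl r (t + 1)).reverse : ℤ) : ℝ) := by
  have h := Bsum_reverse_Zl_bounds r t
  rw [← Int.cast_le (R := ℝ), ← Int.cast_le (R := ℝ)] at h
  simpa only [sylvPred, Int.cast_mul, Int.cast_add, Int.cast_sub, Int.cast_pow, Int.cast_one,
    Int.cast_natCast] using h

/-- Replaces one factor `p` by the slightly smaller `g`, using the slack `f`. -/
theorem sq_le_mul_of_slack {a f p g c K : ℝ} (hc : 0 ≤ c) (hp : 0 ≤ p) (hK : 0 ≤ K)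
    (hmain : a ^ 2 * f ^ 2 ≤ K * p ^ 2) (hratio : 1 + c ≤ f ^ 2 * c)
    (hg : p * c ≤ g * (1 + c)) : a ^ 2 ≤ K * (p * g) := by
  refine le_of_mul_le_mul_right ?_ (by linarith : 0 < 1 + c)
  calc a ^ 2 * (1 + c) ≤ a ^ 2 * (f ^ 2 * c) := by gcongr
    _ = a ^ 2 * f ^ 2 * c := by ring
    _ ≤ K * p ^ 2 * c := by gcongr
    _ = K * p * (p * c) := by ring
    _ ≤ K * p * (g * (1 + c)) := by gcongr
    _ = K * (p * g) * (1 + c) := by ring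

/-- Lemma 8.2 of Esser–Totaro: with
`α := 2·∏_{j=1}^{∞} (s_{j+1}/(s_j − 1)²)^(2^(j−1))`, `P = b_1⋯b_{2r}`,
`Q = b_2⋯b_{2r−1}`, `2b′ = 1 + P + 2t_1`, `3b″ = 1 + 8Q + 12t_2`,
`m′ = 2b′g_1 − 1` (the conjectural index in odd dimension `2r+1`) and
`m″ = 3b″g_2 − 2` (the conjectural index in even dimension `2r`), one has
`m″ ≥ (s_{2r} − 1)(2s_{2r} − 3)/(9α/8)` and
`m′ ≥ (s_{2r+1} − 1)(2s_{2r+1} − 3)/(6α²/7)`. -/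
theorem index_comparison (r : ℕ) (hr : 1 ≤ r) (b' b'' : ℤ)
    (hb' : 2 * b' = 1 + (∏ j ∈ Finset.Icc 1 (2 * r), bexp r j) + 2 * tB r 1)
    (hb'' : 3 * b'' = 1 + 8 * (∏ j ∈ Finset.Icc 2 (2 * r - 1), bexp r j) + 12 * tB r 2)
    (α : ℝ)
    (hα : Filter.Tendsto
      (fun N : ℕ => 2 * ∏ j ∈ Finset.Icc 1 N,
        ((sylv (j + 1) : ℝ) / ((sylv j : ℝ) - 1) ^ 2) ^ 2 ^ (j - 1))
      Filter.atTop (nhds α)) :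
    ((3 * b'' * gB r 2 - 2 : ℤ) : ℝ) ≥
        8 * ((sylv (2 * r) : ℝ) - 1) * (2 * (sylv (2 * r) : ℝ) - 3) / (9 * α) ∧
    ((2 * b' * gB r 1 - 1 : ℤ) : ℝ) ≥
        7 * ((sylv (2 * r + 1) : ℝ) - 1) * (2 * (sylv (2 * r + 1) : ℝ) - 3) / (6 * α ^ 2) := by
  have hA := prod_sylvRatio_le_of_tendsto hα
  have hα_ge : 7 / 2 ≤ α := by
    have := hA 1
    norm_num [sylvRatio, sylv] at this
    linarith
  have hα_pos : 0 < α := by linarith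
  constructor
  · obtain rfl | ⟨t, rfl⟩ : r = 1 ∨ ∃ t, r = t + 2 := by
      rcases Nat.lt_or_ge r 2 with h | h
      · left; omega
      · right; exact ⟨r - 2, by omega⟩
    · norm_num [tB, Lk, Zl, Bsum] at hb''
      norm_num [gB, Lk, Zl, Bsum, sylv]
      obtain rfl : b'' = 7 := by omega
      rw [div_le_iff₀ (by positivity)]
      norm_num
      linarith
    · have hmain := sylvPred_even_le hA t
      have hratio := one_add_sq_le_sylvRatio_sq (t + 2)
      have hprod := prod_Zl_eq_prod_bexp (t + 2) (t + 1) 1 (by omega)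
      have hL : Lk (t + 2) 2 = Zl (t + 2) (t + 1) := rfl
      have hβ := prod_Zl_mul_le (t + 2) t
      obtain ⟨hg, hg'⟩ := cast_Bsum_reverse_Zl_bounds (t + 2) t
      rw [show t + 2 - t = 2 by omega, show sylv 2 = 7 by rfl] at hβ
      rw [tB, hL, show 2 * (t + 2) - 1 = t + 2 + (t + 1) by omega, ← hprod] at hb''
      rw [gB, hL]
      have hp : (1 : ℝ) ≤ (((Zl (t + 2) (t + 1)).prod : ℤ) : ℝ) := by
        exact_mod_cast (Bsum_bounds _ (one_le_of_mem_Zl _ _)).2.2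
      have ha := one_le_sylvPred (2 * (t + 2))
      have hs : (sylv (2 * (t + 2)) : ℝ) = sylvPred (2 * (t + 2)) + 1 := by simp [sylvPred]
      have hc : (4 : ℝ) ≤ sylvPred (t + 2) ^ 2 := four_le_sylvPred_succ_sq _
      have hβR := (Int.cast_le (R := ℝ)).2 hβ
      have hbR := congrArg (Int.cast : ℤ → ℝ) hb''
      simp only [Int.cast_mul, Int.cast_add, Int.cast_sub, Int.cast_one, Int.cast_ofNat,
        Nat.cast_ofNat] at hβR hbR ⊢
      have hsq := sq_le_mul_of_slack (a := sylvPred (2 * (t + 2))) (K := 72 / 7 * α)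
        (by positivity) (by linarith) (by positivity) (by linarith) hratio hg
      rw [hs, ge_iff_le, div_le_iff₀ (by positivity), hbR]
      clear hg hβ hbR hb' hb'' hmain hratio hα hA hprod hL hs
      generalize (((Zl (t + 2) (t + 1)).prod : ℤ) : ℝ) = p at *
      generalize ((Bsum (Zl (t + 2) (t + 1)).reverse : ℤ) : ℝ) = g at *
      generalize ((Bsum (Zl (t + 2) (t + 1)) : ℤ) : ℝ) = β at *
      generalize sylvPred (2 * (t + 2)) = a at *
      have hm : 128 / 7 * (p * g) ≤ (1 + 8 * p + 12 * β) * g - 2 := by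
        nlinarith [mul_le_mul_of_nonneg_right hβR (by linarith : (0 : ℝ) ≤ g)]
      have := mul_le_mul_of_nonneg_right hm (by positivity : 0 ≤ 9 * α)
      nlinarith
  · obtain ⟨t, rfl⟩ : ∃ t, r = t + 1 := ⟨r - 1, by omega⟩
    have hmain := sylvPred_odd_le hA t
    have hratio := one_add_sq_le_sylvRatio_sq (t + 1)
    have hprod := prod_Zl_eq_prod_bexp (t + 1) (t + 1) 0 (by omega)
    have hL : Lk (t + 1) 1 = Zl (t + 1) (t + 1) := rfl
    have hβ := prod_Zl_mul_le (t + 1) t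
    obtain ⟨hg, hg'⟩ := cast_Bsum_reverse_Zl_bounds (t + 1) t
    rw [show t + 1 - t = 1 by omega, show sylv 1 = 3 by rfl] at hβ
    rw [tB, hL, show 2 * (t + 1) = t + 1 + (t + 1) by omega, ← hprod] at hb'
    rw [gB, hL]
    have hp : (1 : ℝ) ≤ (((Zl (t + 1) (t + 1)).prod : ℤ) : ℝ) := by
      exact_mod_cast (Bsum_bounds _ (one_le_of_mem_Zl _ _)).2.2
    have ha := one_le_sylvPred (2 * (t + 1) + 1)
    have hs : (sylv (2 * (t + 1) + 1) : ℝ) = sylvPred (2 * (t + 1) + 1) + 1 := by simp [sylvPred]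
    have hc : (4 : ℝ) ≤ sylvPred (t + 1) ^ 2 := four_le_sylvPred_succ_sq _
    have hβR := (Int.cast_le (R := ℝ)).2 hβ
    have hbR := congrArg (Int.cast : ℤ → ℝ) hb'
    simp only [Int.cast_mul, Int.cast_add, Int.cast_sub, Int.cast_one, Int.cast_ofNat,
      Nat.cast_ofNat] at hβR hbR ⊢
    have hmain_sq := pow_le_pow_left₀ (mul_nonneg (zero_le_one.trans ha)
      (zero_le_one.trans (one_le_sylvRatio _))) hmain 2
    have hsq := sq_le_mul_of_slack (a := sylvPred (2 * (t + 1) + 1)) (K := α ^ 2)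
      (by positivity) (by linarith) (by positivity) (by linarith) hratio hg
    rw [hs, ge_iff_le, div_le_iff₀ (by positivity), hbR]
    clear hg hβ hbR hb' hb'' hmain hmain_sq hratio hα hA hprod hL hs
    generalize (((Zl (t + 1) (t + 1)).prod : ℤ) : ℝ) = p at *
    generalize ((Bsum (Zl (t + 1) (t + 1)).reverse : ℤ) : ℝ) = g at *
    generalize ((Bsum (Zl (t + 1) (t + 1)) : ℤ) : ℝ) = β at *
    generalize sylvPred (2 * (t + 1) + 1) = a at *
    have hm : 7 / 3 * (p * g) ≤ (1 + p + 2 * β) * g - 1 := by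
      nlinarith [mul_le_mul_of_nonneg_right hβR (by linarith : (0 : ℝ) ≤ g)]
    have := mul_le_mul_of_nonneg_right hm (by positivity : 0 ≤ 6 * α ^ 2)
    nlinarith
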